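/- Let C ⊆ ℝ² be a finite set of m centers and let P be a finite family of n linear trajectories in ℝ². Assume that for every c ∈ C and every pair of distinct trajectories a, b ∈ P, the equality ‖c − a(t)‖ = ‖c − b(t)‖ does not hold for all t ∈ ℝ. Then the set E = {t ∈ ℝ : ∃ c ∈ C, ∃ a, b ∈ P with a ≠ b and ‖c − a(t)‖ = ‖c − b(t)‖} is finite and has cardinality at most m·n·(n−1). -/

import Mathlib

open Real

noncomputable section

abbrev Pt := EuclideanSpace ℝ (Fin 2)

def traj (p0 p1 : Pt) (t : ℝ) : Pt := (1 - t) • p0 + t • p1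

/-- The zeros of a quadratic function that does not vanish identically lie in a set of at most
two points. -/
lemma exists_finset_card_le_two_of_quadratic (x y z : ℝ)
    (h : ¬ ∀ t : ℝ, x * t ^ 2 + y * t + z = 0) :
    ∃ T : Finset ℝ, T.card ≤ 2 ∧ ∀ t : ℝ, x * t ^ 2 + y * t + z = 0 → t ∈ T := by
  classical
  let p : Polynomial ℝ := .C x * .X ^ 2 + .C y * .X + .C z
  have heval (t : ℝ) : p.eval t = x * t ^ 2 + y * t + z := by simp [p]
  have hp : p ≠ 0 := by
    intro hp
    exact h fun t => by rw [← heval, hp, Polynomial.eval_zero]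
  refine ⟨p.roots.toFinset, ?_, fun t ht => ?_⟩
  · exact (Multiset.toFinset_card_le _).trans
      (p.card_roots'.trans Polynomial.natDegree_quadratic_le)
  · rw [Multiset.mem_toFinset, Polynomial.mem_roots hp, Polynomial.IsRoot, heval, ht]

/-- The difference of the squared distances from a point to two linear trajectories is a quadratic
function of time. -/
lemma exists_quadratic_eq_sub_sq_dist (c : Pt) (a b : Pt × Pt) :
    ∃ x y z : ℝ, ∀ t : ℝ,
      ‖c - traj a.1 a.2 t‖ ^ 2 - ‖c - traj b.1 b.2 t‖ ^ 2 = x * t ^ 2 + y * t + z := by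
  have key (a : Pt × Pt) (t : ℝ) : ‖c - traj a.1 a.2 t‖ ^ 2 =
      ‖a.1 - a.2‖ ^ 2 * t ^ 2 + 2 * inner ℝ (c - a.1) (a.1 - a.2) * t + ‖c - a.1‖ ^ 2 := by
    have h : c - traj a.1 a.2 t = (c - a.1) + t • (a.1 - a.2) := by
      unfold traj
      module
    rw [h, norm_add_sq_real, norm_smul, inner_smul_right, mul_pow, Real.norm_eq_abs, sq_abs]
    ring
  refine ⟨‖a.1 - a.2‖ ^ 2 - ‖b.1 - b.2‖ ^ 2,
    2 * inner ℝ (c - a.1) (a.1 - a.2) - 2 * inner ℝ (c - b.1) (b.1 - b.2),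
    ‖c - a.1‖ ^ 2 - ‖c - b.1‖ ^ 2, fun t => ?_⟩
  rw [key a, key b]
  ring

/-- Two linear trajectories that are not identically equidistant from a point are equidistant from
it at no more than two times. -/
lemma exists_finset_card_le_two_of_equidistant (c : Pt) (a b : Pt × Pt)
    (h : ¬ ∀ t : ℝ, ‖c - traj a.1 a.2 t‖ = ‖c - traj b.1 b.2 t‖) :
    ∃ T : Finset ℝ, T.card ≤ 2 ∧
      ∀ t : ℝ, ‖c - traj a.1 a.2 t‖ = ‖c - traj b.1 b.2 t‖ → t ∈ T := by
  obtain ⟨x, y, z, hq⟩ := exists_quadratic_eq_sub_sq_dist c a b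
  have hiff (t : ℝ) :
      ‖c - traj a.1 a.2 t‖ = ‖c - traj b.1 b.2 t‖ ↔ x * t ^ 2 + y * t + z = 0 := by
    rw [← hq, sub_eq_zero, sq_eq_sq₀ (norm_nonneg _) (norm_nonneg _)]
  simp only [hiff] at h ⊢
  exact exists_finset_card_le_two_of_quadratic x y z h

/-- With `m` centers and `n` trajectories, and no pair of distinct trajectories
identically equidistant from a center, the set of support-point change events
(times at which two distinct objects are equidistant from some station) is
finite of size at most `m·n·(n−1)`. -/
theorem stmt5 (C : Finset Pt) (P : Finset (Pt × Pt)) (m n : ℕ)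
    (hm : C.card = m) (hn : P.card = n)
    (hnd : ∀ c ∈ C, ∀ a ∈ P, ∀ b ∈ P, a ≠ b →
      ¬ ∀ t : ℝ, ‖c - traj a.1 a.2 t‖ = ‖c - traj b.1 b.2 t‖) :
    {t : ℝ | ∃ c ∈ C, ∃ a ∈ P, ∃ b ∈ P, a ≠ b ∧
        ‖c - traj a.1 a.2 t‖ = ‖c - traj b.1 b.2 t‖}.Finite ∧
    {t : ℝ | ∃ c ∈ C, ∃ a ∈ P, ∃ b ∈ P, a ≠ b ∧
        ‖c - traj a.1 a.2 t‖ = ‖c - traj b.1 b.2 t‖}.ncard ≤ m * n * (n - 1) := by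
  classical
  have hT : ∀ q ∈ C ×ˢ P.powersetCard 2, ∃ T : Finset ℝ, T.card ≤ 2 ∧
      ∀ a ∈ q.2, ∀ b ∈ q.2, a ≠ b → ∀ t : ℝ,
        ‖q.1 - traj a.1 a.2 t‖ = ‖q.1 - traj b.1 b.2 t‖ → t ∈ T := by
    rintro ⟨c, s⟩ hq
    obtain ⟨hc, hs⟩ := Finset.mem_product.1 hq
    obtain ⟨hsP, hs2⟩ := Finset.mem_powersetCard.1 hs
    obtain ⟨a, b, hab, rfl⟩ := Finset.card_eq_two.1 hs2
    obtain ⟨T, hT2, hT⟩ := exists_finset_card_le_two_of_equidistant c a b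
      (hnd c hc a (hsP (by simp)) b (hsP (by simp)) hab)
    refine ⟨T, hT2, fun a' ha' b' hb' hne t ht => hT t ?_⟩
    simp only [Finset.mem_insert, Finset.mem_singleton] at ha' hb'
    rcases ha' with rfl | rfl <;> rcases hb' with rfl | rfl
    · exact absurd rfl hne
    · exact ht
    · exact ht.symm
    · exact absurd rfl hne
  choose! T hT2 hT using hT
  have hsub : {t : ℝ | ∃ c ∈ C, ∃ a ∈ P, ∃ b ∈ P, a ≠ b ∧
      ‖c - traj a.1 a.2 t‖ = ‖c - traj b.1 b.2 t‖} ⊆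
        ((C ×ˢ P.powersetCard 2).biUnion T : Finset ℝ) := by
    rintro t ⟨c, hc, a, ha, b, hb, hab, ht⟩
    have hq : (c, ({a, b} : Finset (Pt × Pt))) ∈ C ×ˢ P.powersetCard 2 :=
      Finset.mem_product.2 ⟨hc, Finset.mem_powersetCard.2
        ⟨by simp [Finset.insert_subset_iff, ha, hb], Finset.card_pair hab⟩⟩
    exact Finset.mem_coe.2 (Finset.mem_biUnion.2
      ⟨_, hq, hT _ hq a (by simp) b (by simp) hab t ht⟩)
  refine ⟨(Finset.finite_toSet _).subset hsub, ?_⟩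
  refine (Set.ncard_le_ncard hsub (Finset.finite_toSet _)).trans ?_
  rw [Set.ncard_coe_finset]
  refine (Finset.card_biUnion_le_card_mul _ _ 2 hT2).trans_eq ?_
  rw [Finset.card_product, Finset.card_powersetCard, hm, hn, Nat.choose_two_right, mul_assoc,
    Nat.div_mul_cancel (Nat.even_mul_pred_self n).two_dvd, mul_assoc]
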